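/- For λ > 0 and -1 < x, y < 1, the product of Gegenbauer polynomials satisfies C_k^λ(x) C_k^λ(y) = ((2λ)_k / k!) ∫_{-1}^{1} C_k^λ(z) K_λ(x,y,z) dz, where K_λ(x,y,z) = (Γ(λ+1/2)/(Γ(λ)Γ(1/2))) · (1-x²-y²-z²+2xyz)^{λ-1} / ((1-x²)^{λ-1/2}(1-y²)^{λ-1/2}) when 1-x²-y²-z²+2xyz > 0, and K_λ(x,y,z) = 0 otherwise. -/

import Mathlib

open scoped Real BigOperators

/-- Pochhammer symbol `(lam)_m`. -/
noncomputable def poch (lam : ℝ) (m : ℕ) : ℝ := (ascPochhammer ℝ m).eval lam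

/-- Gegenbauer polynomial `C_k^lam(x)`, via its explicit representation. -/
noncomputable def gegen (lam : ℝ) (k : ℕ) (x : ℝ) : ℝ :=
  ∑ j ∈ Finset.range (k / 2 + 1),
    (-1 : ℝ) ^ j * poch lam (k - j) / ((Nat.factorial j : ℝ) * (Nat.factorial (k - 2 * j) : ℝ))
      * (2 * x) ^ (k - 2 * j)

/-- The kernel in the variant of Gegenbauer's product formula, extended by zero. -/
noncomputable def Kker (lam x y z : ℝ) : ℝ :=
  if 0 < 1 - x^2 - y^2 - z^2 + 2*x*y*z then
    Real.Gamma (lam + 1/2) / (Real.Gamma lam * Real.Gamma (1/2))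
      * (1 - x^2 - y^2 - z^2 + 2*x*y*z) ^ (lam - 1)
      / ((1 - x^2) ^ (lam - 1/2) * (1 - y^2) ^ (lam - 1/2))
  else 0

section Algebra

open Polynomial

/-- The Gegenbauer differential operator `(1 - X²) p'' - (2 lam + 1) X p'`. -/
noncomputable def gegenOp (lam : ℝ) (p : ℝ[X]) : ℝ[X] :=
  (1 - X ^ 2) * derivative (derivative p) - C (2 * lam + 1) * X * derivative p

lemma gegenOp_add (lam : ℝ) (p q : ℝ[X]) :
    gegenOp lam (p + q) = gegenOp lam p + gegenOp lam q := by
  simp only [gegenOp, derivative_add]; ring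

lemma gegenOp_C_mul (lam c : ℝ) (p : ℝ[X]) :
    gegenOp lam (C c * p) = C c * gegenOp lam p := by
  simp only [gegenOp, derivative_C_mul]; ring

lemma gegenOp_sum {ι : Type*} (lam : ℝ) (s : Finset ι) (p : ι → ℝ[X]) :
    gegenOp lam (∑ i ∈ s, p i) = ∑ i ∈ s, gegenOp lam (p i) := by
  simp only [gegenOp, derivative_sum, Finset.mul_sum, Finset.sum_sub_distrib]

lemma coeff_gegenOp (lam : ℝ) (p : ℝ[X]) (n : ℕ) :
    (gegenOp lam p).coeff n
      = (n + 2) * (n + 1) * p.coeff (n + 2) - n * (n + 2 * lam) * p.coeff n := by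
  have h : gegenOp lam p = derivative (derivative p) - derivative (derivative p) * X ^ 2
      - C (2 * lam + 1) * (derivative p * X) := by
    unfold gegenOp; ring
  rw [h, coeff_sub, coeff_sub, coeff_C_mul]
  rcases n with _ | _ | n
  · simp [coeff_derivative]; ring
  · simp [coeff_derivative, coeff_mul_X_pow']; ring
  · rw [coeff_mul_X_pow, coeff_mul_X]
    simp only [coeff_derivative]; push_cast; ring

/-- A polynomial eigenfunction of the Gegenbauer operator for the eigenvalue `-k(k + 2 lam)`
is determined by its coefficient of degree `k`. -/
lemma eq_zero_of_gegenOp_eq {lam : ℝ} (hlam : 0 < lam) (k : ℕ) {p : ℝ[X]}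
    (h : gegenOp lam p = C (-(k * (k + 2 * lam))) * p) (hk : p.coeff k = 0) : p = 0 := by
  by_contra hp
  have hc := congrArg (fun q : ℝ[X] => q.coeff p.natDegree) h
  simp only [coeff_gegenOp, coeff_C_mul] at hc
  rw [coeff_eq_zero_of_natDegree_lt (by lia : p.natDegree < p.natDegree + 2)] at hc
  have hl : p.coeff p.natDegree ≠ 0 := leadingCoeff_ne_zero.mpr hp
  have hd : ((p.natDegree : ℝ) - k) * (p.natDegree + k + 2 * lam) = 0 := by
    apply mul_right_cancel₀ hl
    linear_combination -hc
  rcases mul_eq_zero.mp hd with hd | hd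
  · have : p.natDegree = k := by exact_mod_cast sub_eq_zero.mp hd
    exact hl (this ▸ hk)
  · have : (0 : ℝ) < p.natDegree + k + 2 * lam := by positivity
    exact this.ne' hd

lemma poch_succ (lam : ℝ) (n : ℕ) : poch lam (n + 1) = poch lam n * (lam + n) := by
  simp [poch, ascPochhammer_succ_right]

lemma poch_succ_left (lam : ℝ) (n : ℕ) : poch lam (n + 1) = lam * poch (lam + 1) n := by
  simp [poch, ascPochhammer_succ_left]

lemma poch_pos {lam : ℝ} (hlam : 0 < lam) (n : ℕ) : 0 < poch lam n :=
  ascPochhammer_pos n lam hlam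

/-- The coefficient of `X ^ (k - 2 j)` in the Gegenbauer polynomial of degree `k`. -/
noncomputable def gegenCoeff (lam : ℝ) (k j : ℕ) : ℝ :=
  (-1 : ℝ) ^ j * poch lam (k - j) / ((Nat.factorial j : ℝ) * (Nat.factorial (k - 2 * j) : ℝ))
    * 2 ^ (k - 2 * j)

/-- The Gegenbauer polynomial as an element of `ℝ[X]`. -/
noncomputable def gegenPoly (lam : ℝ) (k : ℕ) : ℝ[X] :=
  ∑ j ∈ Finset.range (k / 2 + 1), C (gegenCoeff lam k j) * X ^ (k - 2 * j)

lemma eval_gegenPoly (lam : ℝ) (k : ℕ) (x : ℝ) : (gegenPoly lam k).eval x = gegen lam k x := by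
  simp only [gegenPoly, gegen, gegenCoeff, eval_finsetSum, eval_mul, eval_C, eval_pow, eval_X,
    mul_pow, mul_assoc]

lemma gegenCoeff_succ (lam : ℝ) {k j : ℕ} (h : 2 * (j + 1) ≤ k) :
    gegenCoeff lam k (j + 1) * (4 * (j + 1) * (k - (j + 1) + lam))
      = -(gegenCoeff lam k j * ((k - 2 * j) * (k - 2 * j - 1))) := by
  obtain ⟨m, rfl⟩ := Nat.exists_eq_add_of_le h
  have e1 : 2 * (j + 1) + m - (j + 1) = m + j + 1 := by lia
  have e2 : 2 * (j + 1) + m - j = m + j + 1 + 1 := by lia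
  have e3 : 2 * (j + 1) + m - 2 * (j + 1) = m := by lia
  have e4 : 2 * (j + 1) + m - 2 * j = m + 1 + 1 := by lia
  simp only [gegenCoeff, e1, e2, e3, e4, poch_succ lam (m + j + 1), Nat.factorial_succ]
  push_cast
  field_simp
  ring

lemma gegenOp_X_pow (lam : ℝ) (n : ℕ) :
    gegenOp lam (X ^ n) = C (n * (n - 1) : ℝ) * X ^ (n - 2) - C (n * (n + 2 * lam)) * X ^ n := by
  rcases n with _ | _ | n
  · simp [gegenOp]
  · simp [gegenOp, add_comm]
  · simp [gegenOp]
    ring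

lemma gegenOp_gegenPoly (lam : ℝ) (k : ℕ) :
    gegenOp lam (gegenPoly lam k) = C (-(k * (k + 2 * lam))) * gegenPoly lam k := by
  let u : ℕ → ℝ[X] := fun j =>
    C (gegenCoeff lam k j * (4 * j * (k - j + lam))) * X ^ (k - 2 * j)
  let v : ℕ → ℝ[X] := fun j =>
    C (gegenCoeff lam k j * ((k - 2 * j) * (k - 2 * j - 1))) * X ^ (k - 2 * j - 2)
  have key : ∀ m ≤ k / 2, ∑ j ∈ Finset.range (m + 1),
      (gegenOp lam (C (gegenCoeff lam k j) * X ^ (k - 2 * j))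
        + C (k * (k + 2 * lam)) * (C (gegenCoeff lam k j) * X ^ (k - 2 * j))) = v m := by
    have step : ∀ j ≤ k / 2, gegenOp lam (C (gegenCoeff lam k j) * X ^ (k - 2 * j))
        + C (k * (k + 2 * lam)) * (C (gegenCoeff lam k j) * X ^ (k - 2 * j)) = u j + v j := by
      intro j hj
      have hc : ((k - 2 * j : ℕ) : ℝ) = k - 2 * j := by
        rw [Nat.cast_sub (by lia)]; push_cast; ring
      simp only [gegenOp_C_mul, gegenOp_X_pow, hc, u, v, map_mul, map_sub, map_add]
      simp only [C_ofNat, map_one]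
      ring
    intro m
    induction m with
    | zero =>
      intro h
      rw [Finset.sum_range_one, step 0 h]
      simp [u]
    | succ m ih =>
      intro h
      rw [Finset.sum_range_succ, ih (by lia), step _ h]
      have huv : u (m + 1) = -v m := by
        have e : k - 2 * (m + 1) = k - 2 * m - 2 := by lia
        have := gegenCoeff_succ lam (show 2 * (m + 1) ≤ k by lia)
        simp only [u, v, e, Nat.cast_add, Nat.cast_one, this, map_neg, neg_mul]
      rw [huv]; ring
  have h := key _ le_rfl
  have hv : v (k / 2) = 0 := by
    have : ((k : ℝ) - 2 * (k / 2 : ℕ)) * (k - 2 * (k / 2 : ℕ) - 1) = 0 := by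
      rcases Nat.even_or_odd' k with ⟨m, rfl | rfl⟩
      · simp
      · have : (2 * m + 1) / 2 = m := by lia
        rw [this]; push_cast; ring
    simp only [v, this, mul_zero, map_zero, zero_mul]
  rw [hv, Finset.sum_add_distrib, ← gegenOp_sum, ← Finset.mul_sum] at h
  rw [map_neg, neg_mul]
  exact eq_neg_of_add_eq_zero_left h

lemma coeff_gegenPoly_ne_zero {lam : ℝ} (hlam : 0 < lam) (k : ℕ) :
    (gegenPoly lam k).coeff k ≠ 0 := by
  rw [gegenPoly, finsetSum_coeff, Finset.sum_eq_single 0]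
  · have := poch_pos hlam k
    rw [coeff_C_mul]
    simp [gegenCoeff, this.ne', Nat.factorial_ne_zero]
  · intro j hj h0
    have := Finset.mem_range.mp hj
    rw [coeff_C_mul, coeff_X_pow, if_neg (by lia), mul_zero]
  · simp

/-- Polynomial eigenfunctions of the Gegenbauer operator are multiples of `gegenPoly`. -/
lemma exists_eq_C_mul_gegenPoly {lam : ℝ} (hlam : 0 < lam) (k : ℕ) {p : ℝ[X]}
    (h : gegenOp lam p = C (-(k * (k + 2 * lam))) * p) : ∃ a, p = C a * gegenPoly lam k := by
  have hk := coeff_gegenPoly_ne_zero hlam k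
  refine ⟨p.coeff k / (gegenPoly lam k).coeff k, ?_⟩
  have hz : p + C (-(p.coeff k / (gegenPoly lam k).coeff k)) * gegenPoly lam k = 0 := by
    apply eq_zero_of_gegenOp_eq hlam k
    · rw [gegenOp_add, gegenOp_C_mul, h, gegenOp_gegenPoly]; ring
    · rw [coeff_add, coeff_C_mul]; field_simp; ring
  rw [map_neg, neg_mul] at hz
  exact add_neg_eq_zero.mp hz

lemma derivative_gegenPoly_succ (lam : ℝ) (k : ℕ) :
    derivative (gegenPoly lam (k + 1)) = C (2 * lam) * gegenPoly (lam + 1) k := by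
  have hterm : ∀ j ∈ Finset.range (k / 2 + 1),
      derivative (C (gegenCoeff lam (k + 1) j) * X ^ (k + 1 - 2 * j))
        = C (2 * lam) * (C (gegenCoeff (lam + 1) k j) * X ^ (k - 2 * j)) := by
    intro j hj
    have hj := Finset.mem_range.mp hj
    have e1 : k + 1 - 2 * j = k - 2 * j + 1 := by lia
    have e2 : k + 1 - j = k - j + 1 := by lia
    have hc : gegenCoeff lam (k + 1) j * (k - 2 * j + 1 : ℕ)
        = 2 * lam * gegenCoeff (lam + 1) k j := by
      simp only [gegenCoeff, e1, e2, poch_succ_left lam, Nat.factorial_succ]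
      push_cast
      field_simp
      ring
    rw [derivative_C_mul, derivative_X_pow, e1, Nat.add_sub_cancel, ← mul_assoc, ← mul_assoc,
      ← C_mul, ← C_mul, hc]
  rw [gegenPoly, gegenPoly, Finset.mul_sum, ← Finset.sum_congr rfl hterm, derivative_sum]
  rcases Nat.even_or_odd' k with ⟨m, rfl | rfl⟩
  · have : (2 * m + 1) / 2 = 2 * m / 2 := by lia
    rw [this]
  · have : (2 * m + 1 + 1) / 2 = (2 * m + 1) / 2 + 1 := by lia
    rw [this, Finset.sum_range_succ]
    have e : 2 * m + 1 + 1 - 2 * ((2 * m + 1) / 2 + 1) = 0 := by lia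
    simp [e]

lemma gegen_one_eq {lam : ℝ} (hlam : 0 < lam) (k : ℕ) :
    gegen lam k 1 = poch (2 * lam) k / (Nat.factorial k : ℝ) := by
  induction k generalizing lam with
  | zero => simp [gegen, poch]
  | succ k ih =>
    have h := congrArg (eval 1) (gegenOp_gegenPoly lam (k + 1))
    simp only [gegenOp, eval_sub, eval_mul, eval_one, eval_pow, eval_X, eval_C,
      derivative_gegenPoly_succ, eval_gegenPoly, ih (by linarith : 0 < lam + 1)] at h
    have e : 2 * (lam + 1) = 2 * lam + 1 + 1 := by ring
    have hp : poch (2 * lam) (k + 1) * (2 * lam + (k + 1))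
        = 2 * lam * ((2 * lam + 1) * poch (2 * (lam + 1)) k) := by
      rw [e, ← poch_succ_left, ← poch_succ_left, poch_succ (2 * lam) (k + 1)]
      push_cast; ring
    rw [Nat.factorial_succ]
    push_cast at h ⊢
    have hk : (0 : ℝ) < k + 1 + 2 * lam := by positivity
    rw [one_pow, sub_self, zero_mul] at h
    rw [eq_div_iff (by positivity)]
    apply mul_left_cancel₀ hk.ne'
    field_simp at h
    linear_combination h - hp

/-- Iterated derivatives of an eigenfunction of the Gegenbauer operator. -/
lemma gegenOp_iterate_derivative {lam κ : ℝ} {f : ℝ[X]} (hf : gegenOp lam f = C (-κ) * f) (n : ℕ) :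
    (1 - X ^ 2) * derivative^[n + 2] f - C (2 * n + 2 * lam + 1) * X * derivative^[n + 1] f
      = C (n * (n + 2 * lam) - κ) * derivative^[n] f := by
  induction n with
  | zero => simpa [gegenOp] using hf
  | succ n ih =>
    have h := congrArg derivative ih
    simp only [derivative_sub, derivative_mul, derivative_C, derivative_one, derivative_X_pow,
      derivative_X, ← Function.iterate_succ_apply' derivative] at h
    simp only [map_mul, map_sub, map_add, Nat.cast_add, Nat.cast_one, map_one, C_ofNat] at h ⊢
    norm_num [C_ofNat] at h ⊢
    linear_combination h

/-- The normalized even moments `m (2 * j) / (2 * j)!` of the weight `(1 - t²)^(lam - 1)`. -/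
noncomputable def evenMoment (lam : ℝ) : ℕ → ℝ
  | 0 => 1
  | j + 1 => evenMoment lam j / ((2 * j + 2) * (2 * j + 1 + 2 * lam))

/-- The average of `f (x y + √(1-x²) √(1-y²) t)` against the weight `(1 - t²)^(lam - 1)`, as a
polynomial in `x`. -/
noncomputable def meanPoly (lam y : ℝ) (f : ℝ[X]) (N : ℕ) : ℝ[X] :=
  ∑ j ∈ Finset.range N, C (evenMoment lam j * (1 - y ^ 2) ^ j) *
    ((1 - X ^ 2) ^ j * (derivative^[2 * j] f).comp (C y * X))

lemma gegenOp_meanPoly {lam κ : ℝ} (hlam : 0 < lam) (y : ℝ) {f : ℝ[X]}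
    (hf : gegenOp lam f = C (-κ) * f) {N : ℕ} (hN : f.natDegree < 2 * N) :
    gegenOp lam (meanPoly lam y f N) = C (-κ) * meanPoly lam y f N := by
  let h : ℕ → ℝ[X] := fun n => (derivative^[n] f).comp (C y * X)
  have hd : ∀ n, derivative (h n) = C y * h (n + 1) := by
    intro n
    simp only [h, derivative_comp, Function.iterate_succ_apply', derivative_C_mul, derivative_X,
      mul_one]
  have hode : ∀ n : ℕ, (1 - C y ^ 2 * X ^ 2) * h (n + 2)
      - C (2 * n + 2 * lam + 1) * (C y * X) * h (n + 1) = C (n * (n + 2 * lam) - κ) * h n := by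
    intro n
    have := congrArg (fun q : ℝ[X] => q.comp (C y * X)) (gegenOp_iterate_derivative hf n)
    simpa [h, sub_comp, mul_comp, mul_pow] using this
  let u : ℕ → ℝ[X] := fun j =>
    C (evenMoment lam j * (1 - y ^ 2) ^ j * (2 * j * (2 * j - 1 + 2 * lam))) *
      ((1 - X ^ 2) ^ (j - 1) * h (2 * j))
  have step : ∀ j, gegenOp lam (C (evenMoment lam j * (1 - y ^ 2) ^ j) *
        ((1 - X ^ 2) ^ j * h (2 * j)))
      + C κ * (C (evenMoment lam j * (1 - y ^ 2) ^ j) * ((1 - X ^ 2) ^ j * h (2 * j)))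
      = u j - u (j + 1) := by
    intro j
    have hA : evenMoment lam (j + 1) * (1 - y ^ 2) ^ (j + 1)
          * (2 * ((j + 1 : ℕ) : ℝ) * (2 * ((j + 1 : ℕ) : ℝ) - 1 + 2 * lam))
        = evenMoment lam j * (1 - y ^ 2) ^ j * (1 - y ^ 2) := by
      have : (2 * (j : ℝ) + 1 + 2 * lam) ≠ 0 := by positivity
      rw [evenMoment]; push_cast; field_simp; ring
    have ho := hode (2 * j)
    simp only [u, hA, gegenOp_C_mul]
    rw [C_mul (a := evenMoment lam j * (1 - y ^ 2) ^ j) (b := 1 - y ^ 2),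
      C_mul (a := evenMoment lam j * (1 - y ^ 2) ^ j) (b := 2 * (j : ℝ) * (2 * j - 1 + 2 * lam))]
    have main : gegenOp lam ((1 - X ^ 2) ^ j * h (2 * j)) + C κ * ((1 - X ^ 2) ^ j * h (2 * j))
        = C (2 * (j : ℝ) * (2 * j - 1 + 2 * lam)) * ((1 - X ^ 2) ^ (j - 1) * h (2 * j))
          - C (1 - y ^ 2) * ((1 - X ^ 2) ^ j * h (2 * j + 2)) := by
      simp only [map_mul, map_sub, map_add, map_pow, map_one, C_ofNat, Nat.cast_mul,
        Nat.cast_ofNat] at ho ⊢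
      rcases j with _ | _ | j
      all_goals
        simp only [gegenOp, derivative_mul, hd, derivative_C, derivative_sub,
          derivative_one, derivative_pow, derivative_X, map_mul, map_add, map_one, C_ofNat]
        norm_num [C_ofNat] at ho ⊢
      · linear_combination ho
      · linear_combination (1 - X ^ 2) * ho
      · linear_combination (1 - X ^ 2) ^ (j + 2) * ho
    rw [mul_add 2 j 1, Nat.add_sub_cancel]
    linear_combination C (evenMoment lam j * (1 - y ^ 2) ^ j) * main
  have hsum := Finset.sum_congr (rfl : Finset.range N = Finset.range N) (fun j _ => step j)
  rw [Finset.sum_range_sub', Finset.sum_add_distrib, ← gegenOp_sum, ← Finset.mul_sum] at hsum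
  have h0 : u 0 = 0 := by simp [u]
  have hN' : u N = 0 := by simp [u, h, iterate_derivative_eq_zero hN]
  rw [h0, hN', sub_zero] at hsum
  rw [map_neg, neg_mul]
  exact eq_neg_of_add_eq_zero_left hsum

end Algebra

section Moments

open MeasureTheory Polynomial

/-- The constant `Γ(lam + 1/2) / (Γ(lam) Γ(1/2))` normalizing the weight `(1 - t²)^(lam - 1)`. -/
noncomputable def gegenConst (lam : ℝ) : ℝ :=
  Real.Gamma (lam + 1/2) / (Real.Gamma lam * Real.Gamma (1/2))

lemma integral_rpow_mul_one_sub_rpow {lam : ℝ} (hlam : 0 < lam) :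
    ∫ u in (0 : ℝ)..1, u ^ (lam - 1) * (1 - u) ^ (lam - 1)
      = Real.Gamma lam * Real.Gamma lam / Real.Gamma (lam + lam) := by
  have h := ProbabilityTheory.beta_eq_betaIntegralReal lam lam hlam hlam
  rw [ProbabilityTheory.beta] at h
  rw [h, Complex.betaIntegral, ← Complex.ofReal_re (∫ u in (0 : ℝ)..1, _),
    ← intervalIntegral.integral_ofReal]
  congr 1
  refine intervalIntegral.integral_congr fun u hu => ?_
  rw [Set.uIcc_of_le zero_le_one] at hu
  have h1 : (0 : ℝ) ≤ 1 - u := by linarith [hu.2]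
  push_cast [Complex.ofReal_cpow hu.1, Complex.ofReal_cpow h1]
  rfl

lemma gegenConst_mul_integral {lam : ℝ} (hlam : 0 < lam) :
    gegenConst lam * ∫ t in (-1 : ℝ)..1, (1 - t ^ 2) ^ (lam - 1) = 1 := by
  have h := intervalIntegral.integral_comp_mul_add (a := 0) (b := 1)
    (fun t : ℝ => (1 - t ^ 2) ^ (lam - 1)) (two_ne_zero) (-1)
  have hcongr : ∫ u in (0 : ℝ)..1, (1 - (2 * u + -1) ^ 2) ^ (lam - 1)
      = ∫ u in (0 : ℝ)..1, (4 : ℝ) ^ (lam - 1) * (u ^ (lam - 1) * (1 - u) ^ (lam - 1)) := by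
    refine intervalIntegral.integral_congr fun u hu => ?_
    rw [Set.uIcc_of_le zero_le_one] at hu
    have h1 : (0 : ℝ) ≤ 1 - u := by linarith [hu.2]
    rw [← Real.mul_rpow hu.1 h1, ← Real.mul_rpow (by norm_num) (mul_nonneg hu.1 h1)]
    congr 1; ring
  rw [hcongr, intervalIntegral.integral_const_mul, integral_rpow_mul_one_sub_rpow hlam] at h
  norm_num at h
  have hI : ∫ t in (-1 : ℝ)..1, (1 - t ^ 2) ^ (lam - 1)
      = 2 * (4 ^ (lam - 1) * (Real.Gamma lam * Real.Gamma lam / Real.Gamma (lam + lam))) := by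
    rw [h]; ring
  have hd := Real.Gamma_mul_Gamma_add_half lam
  have h4 : (4 : ℝ) ^ (lam - 1) = 2 ^ (2 * lam) / 4 := by
    rw [Real.rpow_sub_one (by norm_num), Real.rpow_mul (by norm_num)]; norm_num
  have h2 : (2 : ℝ) ^ (1 - 2 * lam) = 2 / 2 ^ (2 * lam) := by
    rw [Real.rpow_sub (by norm_num), Real.rpow_one]
  have hp := Real.rpow_pos_of_pos (show (0 : ℝ) < 2 by norm_num) (2 * lam)
  have hg := Real.Gamma_pos_of_pos hlam
  have hg2 := Real.Gamma_pos_of_pos (show 0 < 2 * lam by positivity)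
  have hpi : 0 < √π := Real.sqrt_pos.mpr Real.pi_pos
  rw [hI, gegenConst, Real.Gamma_one_half_eq, ← two_mul lam, h4]
  rw [h2] at hd
  field_simp at hd ⊢
  linear_combination 2 * hd

lemma intervalIntegrable_weight {lam : ℝ} (hlam : 0 < lam) :
    IntervalIntegrable (fun t : ℝ => (1 - t ^ 2) ^ (lam - 1)) volume (-1) 1 := by
  by_contra h
  have := gegenConst_mul_integral hlam
  rw [intervalIntegral.integral_undef h, mul_zero] at this
  exact zero_ne_one this

lemma intervalIntegrable_mul_weight {lam : ℝ} (hlam : 0 < lam) {g : ℝ → ℝ} (hg : Continuous g) :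
    IntervalIntegrable (fun t : ℝ => g t * (1 - t ^ 2) ^ (lam - 1)) volume (-1) 1 :=
  (intervalIntegrable_weight hlam).continuousOn_mul hg.continuousOn

lemma integral_pow_odd_mul_weight (lam : ℝ) (j : ℕ) :
    ∫ t in (-1 : ℝ)..1, t ^ (2 * j + 1) * (1 - t ^ 2) ^ (lam - 1) = 0 := by
  have h := intervalIntegral.integral_comp_neg (a := -1) (b := 1)
    (fun t : ℝ => t ^ (2 * j + 1) * (1 - t ^ 2) ^ (lam - 1))
  have hodd : Odd (2 * j + 1) := odd_two_mul_add_one j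
  simp only [hodd.neg_pow, neg_sq, neg_mul, intervalIntegral.integral_neg, neg_neg] at h
  linarith

lemma integral_pow_add_two_mul_weight {lam : ℝ} (hlam : 0 < lam) (n : ℕ) :
    (n + 1 + 2 * lam) * ∫ t in (-1 : ℝ)..1, t ^ (n + 2) * (1 - t ^ 2) ^ (lam - 1)
      = (n + 1) * ∫ t in (-1 : ℝ)..1, t ^ n * (1 - t ^ 2) ^ (lam - 1) := by
  have hi := fun m : ℕ => intervalIntegrable_mul_weight hlam (continuous_pow (M := ℝ) m)
  have hint := ((hi n).const_mul (n + 1 : ℝ)).sub ((hi (n + 2)).const_mul (n + 1 + 2 * lam))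
  have hcont : ContinuousOn (fun t : ℝ => t ^ (n + 1) * (1 - t ^ 2) ^ lam) (Set.Icc (-1) 1) := by
    refine Continuous.continuousOn ?_
    exact (continuous_pow _).mul ((by fun_prop : Continuous fun t : ℝ => 1 - t ^ 2).rpow_const
      fun _ => Or.inr hlam.le)
  have hder : ∀ t ∈ Set.Ioo (-1 : ℝ) 1,
      HasDerivAt (fun t : ℝ => t ^ (n + 1) * (1 - t ^ 2) ^ lam)
        ((n + 1 : ℝ) * (t ^ n * (1 - t ^ 2) ^ (lam - 1))
          - (n + 1 + 2 * lam) * (t ^ (n + 2) * (1 - t ^ 2) ^ (lam - 1))) t := by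
    intro t ht
    have hpos : 0 < 1 - t ^ 2 := by nlinarith [ht.1, ht.2]
    have h1 : HasDerivAt (fun t : ℝ => 1 - t ^ 2) (-(2 * t)) t := by
      simpa using (hasDerivAt_pow 2 t).const_sub 1
    have h2 := (hasDerivAt_pow (n + 1) t).mul (h1.rpow_const (p := lam) (Or.inl hpos.ne'))
    refine h2.congr_deriv ?_
    have h3 : (1 - t ^ 2) ^ lam = (1 - t ^ 2) * (1 - t ^ 2) ^ (lam - 1) := by
      rw [mul_comm, ← Real.rpow_add_one hpos.ne', sub_add_cancel]
    rw [h3, Nat.add_sub_cancel]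
    push_cast
    ring
  have h := intervalIntegral.integral_eq_sub_of_hasDerivAt_of_le (by norm_num) hcont hder hint
  rw [intervalIntegral.integral_sub ((hi n).const_mul _) ((hi (n + 2)).const_mul _),
    intervalIntegral.integral_const_mul, intervalIntegral.integral_const_mul] at h
  norm_num [Real.zero_rpow hlam.ne'] at h
  linarith

lemma gegenConst_mul_integral_pow_even {lam : ℝ} (hlam : 0 < lam) (j : ℕ) :
    gegenConst lam * ∫ t in (-1 : ℝ)..1, t ^ (2 * j) * (1 - t ^ 2) ^ (lam - 1)
      = (Nat.factorial (2 * j) : ℝ) * evenMoment lam j := by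
  induction j with
  | zero => simpa [evenMoment] using gegenConst_mul_integral hlam
  | succ j ih =>
    have h := integral_pow_add_two_mul_weight hlam (2 * j)
    have e : 2 * (j + 1) = 2 * j + 1 + 1 := by ring
    have hpos : (0 : ℝ) < 2 * j + 1 + 2 * lam := by positivity
    rw [e, Nat.factorial_succ, Nat.factorial_succ, evenMoment]
    push_cast at h ⊢
    apply mul_left_cancel₀ hpos.ne'
    field_simp
    linear_combination (2 * (j : ℝ) + 2) * gegenConst lam * h + (2 * (j : ℝ) + 2) * (2 * j + 1) * ih

lemma eval_meanPoly {lam : ℝ} (hlam : 0 < lam) {x y s : ℝ} {f : ℝ[X]} {N : ℕ}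
    (hN : f.natDegree < 2 * N) (hs : s ^ 2 = (1 - x ^ 2) * (1 - y ^ 2)) :
    (meanPoly lam y f N).eval x
      = gegenConst lam * ∫ t in (-1 : ℝ)..1,
          f.eval (s * t + x * y) * (1 - t ^ 2) ^ (lam - 1) := by
  have hexp : ∀ t : ℝ, f.eval (s * t + x * y) * (1 - t ^ 2) ^ (lam - 1)
      = ∑ i ∈ Finset.range (2 * N), (taylor (x * y) f).coeff i * s ^ i *
          (t ^ i * (1 - t ^ 2) ^ (lam - 1)) := by
    intro t
    rw [← taylor_eval, eval_eq_sum_range' (by rwa [natDegree_taylor]), Finset.sum_mul]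
    exact Finset.sum_congr rfl fun i _ => by rw [mul_pow]; ring
  have hsplit : ∀ (a : ℕ → ℝ) (M : ℕ), (∀ j, a (2 * j + 1) = 0) →
      ∑ i ∈ Finset.range (2 * M), a i = ∑ j ∈ Finset.range M, a (2 * j) := by
    intro a M ha
    induction M with
    | zero => simp
    | succ M ih => rw [mul_add_one, Finset.sum_range_succ, Finset.sum_range_succ, ih, ha,
        Finset.sum_range_succ, add_zero]
  simp only [hexp]
  rw [intervalIntegral.integral_finsetSum
    fun i _ => (intervalIntegrable_mul_weight hlam (continuous_pow i)).const_mul _]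
  simp only [intervalIntegral.integral_const_mul]
  rw [hsplit _ _ fun j => by rw [integral_pow_odd_mul_weight, mul_zero], Finset.mul_sum,
    meanPoly, eval_finsetSum]
  refine Finset.sum_congr rfl fun j _ => ?_
  have hm := gegenConst_mul_integral_pow_even hlam j
  have ht : (Nat.factorial (2 * j) : ℝ) * (taylor (x * y) f).coeff (2 * j)
      = (derivative^[2 * j] f).eval (x * y) := by
    rw [taylor_coeff, ← factorial_smul_hasseDeriv]
    simp
  simp only [eval_mul, eval_C, eval_pow, eval_sub, eval_one, eval_X, eval_comp]
  rw [mul_comm y x, ← ht, pow_mul s, hs, mul_pow]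
  linear_combination (-(taylor (x * y) f).coeff (2 * j) *
    ((1 - x ^ 2) ^ j * (1 - y ^ 2) ^ j)) * hm

lemma integral_mul_Kker {lam : ℝ} {x y : ℝ} (hx : -1 < x) (hx' : x < 1) (hy : -1 < y)
    (hy' : y < 1) (g : ℝ → ℝ) :
    ∫ z in (-1 : ℝ)..1, g z * Kker lam x y z
      = gegenConst lam * ∫ t in (-1 : ℝ)..1,
          g (√((1 - x ^ 2) * (1 - y ^ 2)) * t + x * y) * (1 - t ^ 2) ^ (lam - 1) := by
  have hvx : 0 < 1 - x ^ 2 := by nlinarith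
  have hvy : 0 < 1 - y ^ 2 := by nlinarith
  set q := (1 - x ^ 2) * (1 - y ^ 2) with hq
  have hqpos : 0 < q := mul_pos hvx hvy
  set s := √q with hs
  have hspos : 0 < s := Real.sqrt_pos.mpr hqpos
  have hs2 : s ^ 2 = q := Real.sq_sqrt hqpos.le
  let G : ℝ → ℝ := fun z => g z * (gegenConst lam * (q - (z - x * y) ^ 2) ^ (lam - 1)
    / q ^ (lam - 1 / 2))
  have hK : ∀ z, g z * Kker lam x y z
      = (Set.Ioo (-s + x * y) (s + x * y)).indicator G z := by
    intro z
    have hD : 1 - x ^ 2 - y ^ 2 - z ^ 2 + 2 * x * y * z = q - (z - x * y) ^ 2 := by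
      rw [hq]; ring
    have hmem : 0 < q - (z - x * y) ^ 2 ↔ z ∈ Set.Ioo (-s + x * y) (s + x * y) := by
      rw [sub_pos, ← hs2, sq_lt_sq, abs_of_pos hspos, abs_lt, Set.mem_Ioo,
        lt_sub_iff_add_lt, sub_lt_iff_lt_add]
    rw [Kker, hD]
    by_cases hz : z ∈ Set.Ioo (-s + x * y) (s + x * y)
    · rw [if_pos (hmem.mpr hz), Set.indicator_of_mem hz, ← Real.mul_rpow hvx.le hvy.le]
      rfl
    · rw [if_neg (fun h => hz (hmem.mp h)), Set.indicator_of_notMem hz, mul_zero]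
  have hsub : Set.Ioo (-s + x * y) (s + x * y) ⊆ Set.Ioc (-1) 1 := by
    have hxy : |x * y| < 1 := by
      rw [abs_mul]
      exact mul_lt_one_of_nonneg_of_lt_one_left (abs_nonneg x) (abs_lt.mpr ⟨hx, hx'⟩)
        (abs_lt.mpr ⟨hy, hy'⟩).le
    have h1 := abs_lt.mp hxy
    have hs1 : s ≤ 1 - x * y := Real.sqrt_le_iff.mpr
      ⟨by linarith [h1.2], by rw [hq]; nlinarith [sq_nonneg (x - y)]⟩
    have hs2 : s ≤ 1 + x * y := Real.sqrt_le_iff.mpr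
      ⟨by linarith [h1.1], by rw [hq]; nlinarith [sq_nonneg (x + y)]⟩
    exact fun z hz => ⟨by linarith [hz.1], by linarith [hz.2]⟩
  have hcomp := intervalIntegral.integral_comp_mul_add (a := -1) (b := 1) G hspos.ne' (x * y)
  rw [mul_neg_one, mul_one, smul_eq_mul, eq_inv_mul_iff_mul_eq₀ hspos.ne'] at hcomp
  simp only [hK]
  rw [intervalIntegral.integral_of_le (by norm_num), setIntegral_indicator measurableSet_Ioo,
    Set.inter_eq_self_of_subset_right hsub, ← integral_Ioc_eq_integral_Ioo,
    ← intervalIntegral.integral_of_le (by linarith), ← hcomp,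
    ← intervalIntegral.integral_const_mul, ← intervalIntegral.integral_const_mul]
  refine intervalIntegral.integral_congr fun t ht => ?_
  rw [Set.uIcc_of_le (by norm_num)] at ht
  have ht' : 0 ≤ 1 - t ^ 2 := by nlinarith [ht.1, ht.2]
  have hqt : q - (s * t + x * y - x * y) ^ 2 = q * (1 - t ^ 2) := by
    rw [add_sub_cancel_right, mul_pow, hs2]; ring
  have hpow : q ^ (lam - 1 / 2) = q ^ (lam - 1) * s := by
    rw [hs, Real.sqrt_eq_rpow, ← Real.rpow_add hqpos]
    congr 1; ring
  have hqp := Real.rpow_pos_of_pos hqpos (lam - 1)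
  simp only [G]
  rw [hqt, Real.mul_rpow hqpos.le ht', hpow]
  field_simp

end Moments

theorem gegenbauer_product_formula (lam : ℝ) (hlam : 0 < lam) (x y : ℝ)
    (hx : -1 < x) (hx' : x < 1) (hy : -1 < y) (hy' : y < 1) (k : ℕ) :
    gegen lam k x * gegen lam k y
      = poch (2*lam) k / (Nat.factorial k : ℝ)
        * ∫ z in (-1:ℝ)..1, gegen lam k z * Kker lam x y z := by
  set N := (gegenPoly lam k).natDegree + 1 with hNdef
  have hN : (gegenPoly lam k).natDegree < 2 * N := by lia
  have hq : 0 ≤ (1 - x ^ 2) * (1 - y ^ 2) := mul_nonneg (by nlinarith) (by nlinarith)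
  have hmean := eval_meanPoly hlam hN (Real.sq_sqrt hq)
  simp only [eval_gegenPoly] at hmean
  obtain ⟨a, ha⟩ := exists_eq_C_mul_gegenPoly hlam k
    (gegenOp_meanPoly hlam y (gegenOp_gegenPoly lam k) hN)
  have hone : (meanPoly lam y (gegenPoly lam k) N).eval 1 = gegen lam k y := by
    rw [meanPoly, hNdef, Finset.sum_range_succ', Polynomial.eval_add, Polynomial.eval_finsetSum,
      Finset.sum_eq_zero fun j _ => by simp]
    simp [evenMoment, eval_gegenPoly]
  rw [ha, Polynomial.eval_mul, Polynomial.eval_C, eval_gegenPoly] at hone hmean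
  rw [integral_mul_Kker hx hx' hy hy', ← hmean, ← hone, ← gegen_one_eq hlam]
  ring
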